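/- A sequence u = (u_n)_{n ≥ 0} over a finite alphabet is Sturmian if and only if its palindrome complexity satisfies pal_u(k) = 2 for every odd k ≥ 1 and pal_u(k) = 1 for every even k ≥ 2. -/

import Mathlib

namespace PalPaper

variable {α : Type*}

/-- The finite word `u i, u (i+1), …, u (i+k-1)` read off the infinite sequence `u`. -/
def factorAt (u : ℕ → α) (i k : ℕ) : List α :=
  (List.range k).map fun j => u (i + j)

/-- `w` occurs as a contiguous block (factor) in the infinite sequence `u`. -/
def IsFactor (u : ℕ → α) (w : List α) : Prop :=
  ∃ i, w = factorAt u i w.length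

/-- A palindrome is a word equal to its reversal. -/
def IsPalindrome (w : List α) : Prop := w.reverse = w

/-- Number of distinct factors of length `k` of `u`. -/
noncomputable def facComplexity (u : ℕ → α) (k : ℕ) : ℕ :=
  Set.ncard {w : List α | w.length = k ∧ IsFactor u w}

/-- Number of distinct palindromic factors of length `k` of `u`. -/
noncomputable def palComplexity (u : ℕ → α) (k : ℕ) : ℕ :=
  Set.ncard {w : List α | w.length = k ∧ IsFactor u w ∧ IsPalindrome w}

/-- `p ≥ 1` is a period of the finite word `w`. -/
def IsPeriodOf (p : ℕ) (w : List α) : Prop :=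
  1 ≤ p ∧ ∀ i (h : i + p < w.length), w[i]'(by omega) = w[i + p]'h

/-- The minimal period of a finite word. -/
noncomputable def minPeriod (w : List α) : ℕ := sInf {p | IsPeriodOf p w}

/-- The prefix of length `m` of the infinite sequence `u`, as a finite word. -/
def seqPrefix (u : ℕ → α) (m : ℕ) : List α := (List.range m).map u

/-- The word `σ(u 0) σ(u 1) ⋯ σ(u (n-1))`. -/
def substPrefix (σ : α → List α) (u : ℕ → α) (n : ℕ) : List α :=
  (List.range n).flatMap fun i => σ (u i)

/-- `v = σ(u)`: every word `σ(u 0) ⋯ σ(u (n-1))` is the corresponding prefix of `v`. -/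
def IsMorphicImage (σ : α → List α) (u v : ℕ → α) : Prop :=
  ∀ n, substPrefix σ u n = seqPrefix v (substPrefix σ u n).length

/-- `u` is a fixed point of the morphism `σ`, i.e. `σ(u) = u`. -/
def IsFixedPointOf (σ : α → List α) (u : ℕ → α) : Prop := IsMorphicImage σ u u

/-- The `k`-th iterate of a morphism, applied to a letter. -/
def morphIter (σ : α → List α) : ℕ → α → List α
  | 0, a => [a]
  | k + 1, a => (σ a).flatMap (morphIter σ k)

/-- A morphism is primitive if some iterate maps every letter to a word
containing every letter. -/
def IsPrimitive (σ : α → List α) : Prop :=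
  ∃ k, 1 ≤ k ∧ ∀ a b : α, b ∈ morphIter σ k a

section Factors

lemma length_factorAt (u : ℕ → α) (i k : ℕ) : (factorAt u i k).length = k := by
  simp [factorAt]

lemma getElem_factorAt (u : ℕ → α) (i k t : ℕ) (h : t < (factorAt u i k).length) :
    (factorAt u i k)[t] = u (i + t) := by
  simp [factorAt]

lemma factorAt_add (u : ℕ → α) (i k l : ℕ) :
    factorAt u i (k + l) = factorAt u i k ++ factorAt u (i + k) l := by
  simp [factorAt, List.range_add, Function.comp_def, add_assoc]

lemma factorAt_one (u : ℕ → α) (i : ℕ) : factorAt u i 1 = [u i] := by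
  simp [factorAt]

lemma factorAt_succ (u : ℕ → α) (i k : ℕ) :
    factorAt u i (k + 1) = factorAt u i k ++ [u (i + k)] := by
  rw [factorAt_add, factorAt_one]

lemma factorAt_succ_left (u : ℕ → α) (i k : ℕ) :
    factorAt u i (k + 1) = u i :: factorAt u (i + 1) k := by
  rw [add_comm, factorAt_add, factorAt_one]; rfl

lemma factorAt_eq_iff (u : ℕ → α) (i j k : ℕ) :
    factorAt u i k = factorAt u j k ↔ ∀ t < k, u (i + t) = u (j + t) := by
  simp [factorAt]

lemma isPalindrome_factorAt_iff (u : ℕ → α) (i k : ℕ) :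
    IsPalindrome (factorAt u i k) ↔ ∀ t < k, u (i + t) = u (i + (k - 1 - t)) := by
  rw [IsPalindrome, eq_comm, List.ext_getElem_iff]
  simp [length_factorAt, getElem_factorAt]

lemma isFactor_factorAt (u : ℕ → α) (i k : ℕ) : IsFactor u (factorAt u i k) :=
  ⟨i, by rw [length_factorAt]⟩

lemma IsFactor.exists_eq {u : ℕ → α} {w : List α} {k : ℕ} (h : IsFactor u w)
    (hk : w.length = k) : ∃ i, factorAt u i k = w := by
  obtain ⟨i, hi⟩ := h
  exact ⟨i, by rw [← hk, ← hi]⟩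

lemma IsFactor.left_of_append {u : ℕ → α} {x y : List α} (h : IsFactor u (x ++ y)) :
    IsFactor u x := by
  obtain ⟨i, hi⟩ := h
  rw [List.length_append, factorAt_add] at hi
  exact ⟨i, (List.append_inj hi (by simp [length_factorAt])).1⟩

lemma IsFactor.right_of_append {u : ℕ → α} {x y : List α} (h : IsFactor u (x ++ y)) :
    IsFactor u y := by
  obtain ⟨i, hi⟩ := h
  rw [List.length_append, factorAt_add] at hi
  exact ⟨i + x.length, (List.append_inj hi (by simp [length_factorAt])).2⟩

lemma IsFactor.exists_append {u : ℕ → α} {x : List α} (h : IsFactor u x) :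
    ∃ c, IsFactor u (x ++ [c]) := by
  obtain ⟨i, hi⟩ := h
  refine ⟨u (i + x.length), ?_⟩
  nth_rw 1 [hi]
  rw [← factorAt_succ]
  exact isFactor_factorAt _ _ _

lemma isPalindrome_cons_append_iff (c : α) (w : List α) :
    IsPalindrome (c :: w ++ [c]) ↔ IsPalindrome w := by
  simp [IsPalindrome]

lemma IsPalindrome.exists_eq_cons_append {w : List α} {k : ℕ} (h : IsPalindrome w)
    (hk : w.length = k + 2) : ∃ c x, w = c :: x ++ [c] ∧ x.length = k ∧ IsPalindrome x := by
  obtain ⟨c, y, rfl⟩ := List.exists_cons_of_length_eq_add_one hk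
  rcases List.eq_nil_or_concat y with rfl | ⟨x, d, rfl⟩
  · simp at hk
  · have hcd : d = c := by
      have := h
      simp [IsPalindrome] at this
      exact this.1
    subst hcd
    refine ⟨d, x, by simp, by simpa using hk, ?_⟩
    rwa [← isPalindrome_cons_append_iff d, List.cons_append, ← List.concat_eq_append]

end Factors

section Words

/-- The words of length `k` in a language `L`. -/
def wordsOfLength (L : Set (List α)) (k : ℕ) : Set (List α) := {w | w.length = k ∧ w ∈ L}

/-- The words of length `k` in `L` both of whose one-letter right extensions lie in `L`. -/
def rightSpecial (L : Set (List Bool)) (k : ℕ) : Set (List Bool) :=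
  {w | w.length = k ∧ ∀ c, w ++ [c] ∈ L}

/-- A language closed under taking prefixes and suffixes. -/
def IsFactorial (L : Set (List α)) : Prop :=
  ∀ x y, x ++ y ∈ L → x ∈ L ∧ y ∈ L

/-- Words of `L` of equal length at most `n` have numbers of letters `true` differing by at
most one. -/
def IsBalancedUpTo (L : Set (List Bool)) (n : ℕ) : Prop :=
  ∀ x ∈ L, ∀ y ∈ L, x.length = y.length → x.length ≤ n → x.count true ≤ y.count true + 1

lemma finite_setOf_length_eq [Finite α] (k : ℕ) : {w : List α | w.length = k}.Finite :=
  List.finite_length_eq α k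

lemma finite_wordsOfLength [Finite α] (L : Set (List α)) (k : ℕ) : (wordsOfLength L k).Finite :=
  (finite_setOf_length_eq k).subset fun _ h => h.1

lemma finite_rightSpecial (L : Set (List Bool)) (k : ℕ) : (rightSpecial L k).Finite :=
  (finite_setOf_length_eq k).subset fun _ h => h.1

lemma ncard_wordsOfLength_succ (L : Set (List Bool)) (k : ℕ) :
    (wordsOfLength L (k + 1)).ncard =
      {w : List Bool | w.length = k ∧ ∃ c, w ++ [c] ∈ L}.ncard + (rightSpecial L k).ncard := by
  set X : Bool → Set (List Bool) := fun c => {w | w.length = k ∧ w ++ [c] ∈ L}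
  have hX : ∀ c, (X c).Finite := fun c => (finite_setOf_length_eq k).subset fun _ h => h.1
  have h1 : {w : List Bool | w.length = k ∧ ∃ c, w ++ [c] ∈ L} = X true ∪ X false := by
    ext w; simp [X]; tauto
  have h2 : rightSpecial L k = X true ∩ X false := by
    ext w; simp [X, rightSpecial]; tauto
  have h3 : wordsOfLength L (k + 1) =
      (fun w => w ++ [true]) '' X true ∪ (fun w => w ++ [false]) '' X false := by
    ext w
    constructor
    · rintro ⟨hl, hw⟩
      rcases List.eq_nil_or_concat w with rfl | ⟨x, c, rfl⟩
      · simp at hl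
      · rw [List.concat_eq_append] at hw hl ⊢
        cases c
        · exact Or.inr ⟨x, ⟨by simpa using hl, hw⟩, rfl⟩
        · exact Or.inl ⟨x, ⟨by simpa using hl, hw⟩, rfl⟩
    · rintro (⟨x, ⟨hl, hx⟩, rfl⟩ | ⟨x, ⟨hl, hx⟩, rfl⟩)
      · exact ⟨by simpa using hl, hx⟩
      · exact ⟨by simpa using hl, hx⟩
  rw [h1, h2, Set.ncard_union_add_ncard_inter _ _ (hX _) (hX _), h3, Set.ncard_union_eq _
    ((hX _).image _) ((hX _).image _), Set.ncard_image_of_injective _ (List.append_left_injective _),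
    Set.ncard_image_of_injective _ (List.append_left_injective _)]
  rw [Set.disjoint_left]
  rintro _ ⟨x, -, rfl⟩ ⟨y, -, h⟩
  simpa using (List.append_inj' h rfl).2

lemma exists_common_prefix {x y : List Bool} (hl : x.length = y.length) (h : x ≠ y) :
    ∃ z c x' y', x = z ++ c :: x' ∧ y = z ++ (!c) :: y' := by
  induction x generalizing y with
  | nil => cases y <;> simp_all
  | cons a x ih =>
    cases y with
    | nil => simp at hl
    | cons b y =>
      by_cases hab : a = b
      · subst hab
        obtain ⟨z, c, x', y', rfl, rfl⟩ := ih (by simpa using hl) (by simpa using h)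
        exact ⟨a :: z, c, x', y', rfl, rfl⟩
      · refine ⟨[], a, x, y, rfl, ?_⟩
        cases a <;> cases b <;> simp_all

lemma exists_common_suffix {x y : List Bool} (hl : x.length = y.length) (h : x ≠ y) :
    ∃ z c x' y', x = x' ++ c :: z ∧ y = y' ++ (!c) :: z := by
  obtain ⟨z, c, x', y', hx, hy⟩ := exists_common_prefix (x := x.reverse) (y := y.reverse)
    (by simpa using hl) (by simpa using h)
  refine ⟨z.reverse, c, x'.reverse, y'.reverse, ?_, ?_⟩
  · rw [← List.reverse_reverse x, hx]; simp
  · rw [← List.reverse_reverse y, hy]; simp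

lemma IsFactorial.subset_rightSpecial {L : Set (List Bool)} (hL : IsFactorial L) {k : ℕ}
    {c : Bool} {w : List Bool} (h : c :: w ∈ rightSpecial L (k + 1)) : w ∈ rightSpecial L k :=
  ⟨by simpa using h.1, fun d => (hL [c] (w ++ [d]) (h.2 d)).2⟩

lemma IsBalancedUpTo.notMem {L : Set (List Bool)} {n : ℕ} (h : IsBalancedUpTo L n)
    {x y : List Bool} (hlen : x.length = y.length) (hn : x.length + 2 ≤ n)
    (hxy : x.count true = y.count true) (hx : true :: x ++ [true] ∈ L) :
    false :: y ++ [false] ∉ L := by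
  intro hy
  have := h _ hx _ hy (by simpa using hlen) (by simp; omega)
  simp at this
  omega

lemma IsBalancedUpTo.rightSpecial_subsingleton {L : Set (List Bool)} (hL : IsFactorial L) {n k : ℕ}
    (h : IsBalancedUpTo L n) (hk : k < n) : (rightSpecial L k).Subsingleton := by
  intro x hx y hy
  by_contra hne
  obtain ⟨z, c, x', y', rfl, rfl⟩ := exists_common_suffix (hx.1.trans hy.1.symm) hne
  have h1 : ∀ d, c :: z ++ [d] ∈ L := fun d => (hL x' _ (by simpa using hx.2 d)).2
  have h2 : ∀ d, (!c) :: z ++ [d] ∈ L := fun d => (hL y' _ (by simpa using hy.2 d)).2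
  have hz : z.length + 2 ≤ n := by have := hx.1; simp at this; omega
  cases c
  · exact h.notMem rfl hz rfl (h2 true) (h1 false)
  · exact h.notMem rfl hz rfl (h1 true) (h2 false)

lemma IsBalancedUpTo.ncard_wordsOfLength_le {L : Set (List Bool)} (hL : IsFactorial L) {n k : ℕ}
    (h : IsBalancedUpTo L n) (hk : k ≤ n) : (wordsOfLength L k).ncard ≤ k + 1 := by
  induction k with
  | zero =>
    exact (Set.ncard_le_ncard (t := {[]}) (fun w hw => List.length_eq_zero_iff.1 hw.1)).trans
      (by simp)
  | succ k ih =>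
    rw [ncard_wordsOfLength_succ]
    have h1 : {w : List Bool | w.length = k ∧ ∃ c, w ++ [c] ∈ L}.ncard ≤
        (wordsOfLength L k).ncard :=
      Set.ncard_le_ncard (fun w ⟨hw, c, hc⟩ => ⟨hw, (hL _ _ hc).1⟩) (finite_wordsOfLength L k)
    have h2 := (Set.ncard_le_one (finite_rightSpecial L k)).2
      (h.rightSpecial_subsingleton hL hk)
    have := ih (by omega)
    omega

lemma exists_palindrome_of_not_balanced {L : Set (List Bool)} (hL : IsFactorial L)
    (h : ¬ ∀ n, IsBalancedUpTo L n) :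
    ∃ w, IsPalindrome w ∧ (∀ c, c :: w ++ [c] ∈ L) ∧ IsBalancedUpTo L (w.length + 1) := by
  classical
  push Not at h
  set n := Nat.find h with hn
  have hmin : ∀ k < n, IsBalancedUpTo L k := fun k hk => not_not.1 (Nat.find_min h hk)
  have hspec : ¬ IsBalancedUpTo L n := Nat.find_spec h
  have hsmall : ∀ x ∈ L, ∀ y ∈ L, x.length = y.length → x.length < n →
      x.count true ≤ y.count true + 1 := fun x hx y hy hxy hlt =>
    hmin _ hlt x hx y hy hxy le_rfl
  unfold IsBalancedUpTo at hspec
  push Not at hspec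
  obtain ⟨x, hx, y, hy, hlen, hxn, hcount⟩ := hspec
  have hxn' : x.length = n := by
    by_contra hne
    exact absurd (hsmall x hx y hy hlen (by omega)) (by omega)
  rcases x with _ | ⟨c, x⟩
  · simp at hcount
  rcases y with _ | ⟨d, y⟩
  · simp at hlen
  have hx1 := (hL [c] x hx).2
  have hy1 := (hL [d] y hy).2
  simp only [List.length_cons, add_left_inj] at hlen hxn'
  have h1 := hsmall x hx1 y hy1 hlen (by omega)
  have hcd : c = true ∧ d = false := by
    cases c <;> cases d <;> simp at hcount ⊢ <;> omega
  obtain ⟨rfl, rfl⟩ := hcd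
  rcases List.eq_nil_or_concat x with rfl | ⟨x, c, rfl⟩
  · simp at hcount
  rcases List.eq_nil_or_concat y with rfl | ⟨y, d, rfl⟩
  · simp at hlen
  simp only [List.concat_eq_append, List.length_append, List.length_singleton, add_left_inj]
    at hx hy hlen hxn' hcount
  have hx2 := (hL (true :: x) [c] hx).1
  have hy2 := (hL (false :: y) [d] hy).1
  have h2 := hsmall _ hx2 _ hy2 (by simpa using hlen) (by simp; omega)
  have hcd : c = true ∧ d = false := by
    cases c <;> cases d <;> simp at hcount h2 ⊢ <;> omega
  obtain ⟨rfl, rfl⟩ := hcd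
  have hxy : x = y := by
    by_contra hne
    obtain ⟨z, c, x', y', rfl, rfl⟩ := exists_common_prefix hlen hne
    simp only [List.length_append, List.length_cons] at hxn' hlen
    cases c
    · have hx3 : x' ++ [true] ∈ L := (hL (true :: z ++ [false]) _ (by simpa using hx)).2
      have hy3 : y' ++ [false] ∈ L := (hL (false :: z ++ [true]) _ (by simpa using hy)).2
      have := hsmall _ hx3 _ hy3 (by simp; omega) (by simp; omega)
      simp at this hcount
      omega
    · have hx3 : true :: z ++ [true] ∈ L := (hL _ (x' ++ [true]) (by simpa using hx)).1
      have hy3 : false :: z ++ [false] ∈ L := (hL _ (y' ++ [false]) (by simpa using hy)).1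
      have := hsmall _ hx3 _ hy3 (by simp) (by simp; omega)
      simp at this
  subst hxy
  refine ⟨x, ?_, ?_, ?_⟩
  · by_contra hne
    obtain ⟨z, c, r, r', hr, hr'⟩ := exists_common_prefix (by simp) (Ne.symm hne)
    have hr'' : x = r'.reverse ++ (!c) :: z.reverse := by
      rw [← List.reverse_reverse x, hr']; simp
    have hlr : r.length + z.length + 1 = x.length := by rw [hr]; simp; omega
    cases c
    · have hx3 : false :: z ++ [false] ∈ L :=
        (hL _ (r ++ [false]) (by rw [hr] at hy; simpa using hy)).1
      have hy3 : true :: z.reverse ++ [true] ∈ L :=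
        (hL (true :: r'.reverse) _ (by rw [hr''] at hx; simpa using hx)).2
      have := hsmall _ hy3 _ hx3 (by simp) (by simp; omega)
      simp at this
    · have hx3 : true :: z ++ [true] ∈ L :=
        (hL _ (r ++ [true]) (by rw [hr] at hx; simpa using hx)).1
      have hy3 : false :: z.reverse ++ [false] ∈ L :=
        (hL (false :: r'.reverse) _ (by rw [hr''] at hy; simpa using hy)).2
      have := hsmall _ hx3 _ hy3 (by simp) (by simp; omega)
      simp at this
  · rintro (_ | _)
    · exact hy
    · exact hx
  · exact hmin _ (by omega)

end Words

section Language

/-- The language of a sequence: the set of its factors. -/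
def language (u : ℕ → α) : Set (List α) := {w | IsFactor u w}

lemma isFactorial_language (u : ℕ → α) : IsFactorial (language u) :=
  fun _ _ h => ⟨h.left_of_append, h.right_of_append⟩

lemma facComplexity_eq (u : ℕ → α) (k : ℕ) :
    facComplexity u k = (wordsOfLength (language u) k).ncard := rfl

lemma facComplexity_zero (u : ℕ → α) : facComplexity u 0 = 1 := by
  rw [facComplexity, Set.ncard_eq_one]
  refine ⟨[], Set.ext fun w => ⟨fun h => List.length_eq_zero_iff.1 h.1, ?_⟩⟩
  rintro rfl
  exact ⟨rfl, isFactor_factorAt u 0 0⟩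

lemma facComplexity_succ (u : ℕ → Bool) (k : ℕ) :
    facComplexity u (k + 1) = facComplexity u k + (rightSpecial (language u) k).ncard := by
  rw [facComplexity_eq, ncard_wordsOfLength_succ]
  congr 2
  ext w
  exact and_congr_right fun _ => ⟨fun ⟨c, hc⟩ => IsFactor.left_of_append hc,
    fun h => IsFactor.exists_append h⟩

lemma factorAt_eq_cons_iff (u : ℕ → α) (x k : ℕ) (c : α) (w : List α) :
    factorAt u x (k + 1) = c :: w ↔ u x = c ∧ factorAt u (x + 1) k = w := by
  rw [factorAt_succ_left, List.cons.injEq]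

lemma factorAt_eq_cons_append_iff (u : ℕ → α) (x k : ℕ) (c d : α) (w : List α) :
    factorAt u x (k + 2) = c :: w ++ [d] ↔
      u x = c ∧ factorAt u (x + 1) k = w ∧ u (x + 1 + k) = d := by
  rw [List.cons_append, factorAt_eq_cons_iff, factorAt_succ]
  refine and_congr_right fun _ => ⟨fun h => ?_, fun ⟨h1, h2⟩ => by rw [h1, h2]⟩
  have := List.append_inj' h rfl
  simpa using this

lemma IsPalindrome.central {u : ℕ → α} {x k r : ℕ}
    (h : IsPalindrome (factorAt u x (k + 2 * r))) : IsPalindrome (factorAt u (x + r) k) := by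
  rw [isPalindrome_factorAt_iff] at h ⊢
  intro t ht
  have := h (r + t) (by omega)
  rw [show k + 2 * r - 1 - (r + t) = r + (k - 1 - t) by omega] at this
  simpa [add_assoc] using this

/-- If the palindrome `w` is preceded and followed by the letter `c` at position `i`, then every
occurrence of `w` that starts close enough to `i` is preceded by `c`. -/
lemma eq_of_factorAt_palindrome {u : ℕ → α} {w : List α} {i s m : ℕ} {c d : α}
    (hw : IsPalindrome w) (h : factorAt u i (m + 2) = c :: w ++ [c]) (hs : s ≤ m + 1)
    (h' : factorAt u (i + s) (m + 1) = d :: w) : d = c := by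
  obtain ⟨h1, h2, h3⟩ := (factorAt_eq_cons_append_iff u i m c c w).1 h
  obtain ⟨h4, h5⟩ := (factorAt_eq_cons_iff u _ m d w).1 h'
  rw [← h2, isPalindrome_factorAt_iff] at hw
  have h6 := (factorAt_eq_iff u _ _ _).1 (h5.trans h2.symm)
  rcases Nat.eq_zero_or_pos s with rfl | hs0
  · exact h4.symm.trans h1
  rcases hs.eq_or_lt with rfl | hs1
  · rw [← h4, ← h3]; congr 1; omega
  · have h7 := hw (s - 1) (by omega)
    rw [← h6 (m - 1 - (s - 1)) (by omega), show i + 1 + (s - 1) = i + s by omega, h4,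
      show i + s + 1 + (m - 1 - (s - 1)) = i + 1 + m by omega, h3] at h7
    exact h7

lemma isPalindrome_of_return {u : ℕ → α} {w : List α} {i d m : ℕ} (hw : IsPalindrome w)
    (h : factorAt u (i + 1) m = w) (h' : factorAt u (i + d + 1) m = w) (hd : d ≤ m + 1) :
    IsPalindrome (factorAt u (i + 1) (m + d)) := by
  have h1 := (factorAt_eq_iff u _ _ _).1 (h'.trans h.symm)
  rw [← h, isPalindrome_factorAt_iff] at hw
  rw [isPalindrome_factorAt_iff]
  intro t ht
  by_cases ht1 : t < m
  · rw [hw t ht1, ← h1 (m - 1 - t) (by omega)]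
    congr 1; omega
  by_cases ht2 : d ≤ t
  · have := h1 (t - d) (by omega)
    rw [hw (t - d) (by omega)] at this
    rw [show i + 1 + t = i + d + 1 + (t - d) by omega, this]
    congr 1; omega
  · congr 1; omega

lemma eq_of_notMem_rightSpecial {u : ℕ → Bool} {x y k : ℕ}
    (h : factorAt u x k = factorAt u y k) (hx : factorAt u x k ∉ rightSpecial (language u) k) :
    factorAt u x (k + 1) = factorAt u y (k + 1) := by
  rw [factorAt_succ, factorAt_succ, h]
  by_contra hne
  refine hx ⟨length_factorAt _ _ _, fun c => ?_⟩
  have h1 : factorAt u x k ++ [u (x + k)] ∈ language u := by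
    rw [← factorAt_succ]; exact isFactor_factorAt _ _ _
  have h2 : factorAt u x k ++ [u (y + k)] ∈ language u := by
    rw [h, ← factorAt_succ]; exact isFactor_factorAt _ _ _
  cases c <;> cases h3 : u (x + k) <;> cases h4 : u (y + k) <;> simp_all

lemma factorAt_add_period {u : ℕ → Bool} {i p k : ℕ} (hp : 0 < p)
    (h : factorAt u i k = factorAt u (i + p) k)
    (hns : ∀ t < p, factorAt u (i + t) k ∉ rightSpecial (language u) k) (t : ℕ) :
    factorAt u (i + t) (k + 1) = factorAt u (i + t + p) (k + 1) := by
  have key : ∀ t, factorAt u (i + t) k = factorAt u (i + t + p) k ∧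
      factorAt u (i + t) k ∉ rightSpecial (language u) k := by
    intro t
    induction t using Nat.strong_induction_on with
    | _ t ih =>
      have h1 : factorAt u (i + t) k = factorAt u (i + t + p) k := by
        rcases t with _ | t
        · exact h
        · obtain ⟨h2, h3⟩ := ih t (by omega)
          have := eq_of_notMem_rightSpecial h2 h3
          rw [factorAt_succ_left, factorAt_succ_left] at this
          rw [show i + (t + 1) + p = i + t + p + 1 by omega]
          exact (List.cons.inj this).2
      refine ⟨h1, ?_⟩
      by_cases htp : t < p
      · exact hns t htp
      · obtain ⟨h2, h3⟩ := ih (t - p) (by omega)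
        rwa [h2, show i + (t - p) + p = i + t by omega] at h3
  exact eq_of_notMem_rightSpecial (key t).1 (key t).2

lemma exists_lt_factorAt_eq {u : ℕ → α} {N p : ℕ} (hp : 0 < p)
    (h : ∀ x ≥ N, u (x + p) = u x) (k : ℕ) {x : ℕ} (hx : N ≤ x) :
    ∃ y, N ≤ y ∧ y < N + p ∧ factorAt u y k = factorAt u x k := by
  induction x using Nat.strong_induction_on with
  | _ x ih =>
    by_cases hxp : x < N + p
    · exact ⟨x, hx, hxp, rfl⟩
    · obtain ⟨y, hNy, hy, hyx⟩ := ih (x - p) (by omega) (by omega)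
      refine ⟨y, hNy, hy, hyx.trans ((factorAt_eq_iff _ _ _ _).2 fun t _ => ?_)⟩
      rw [← h (x - p + t) (by omega)]
      congr 1; omega

lemma facComplexity_le_of_periodic {u : ℕ → α} {N p : ℕ} (hp : 0 < p)
    (h : ∀ x ≥ N, u (x + p) = u x) (k : ℕ) : facComplexity u k ≤ N + p := by
  classical
  have hsub : {w : List α | w.length = k ∧ IsFactor u w} ⊆
      ((Finset.range (N + p)).image fun x => factorAt u x k : Finset (List α)) := by
    rintro w ⟨hk, hw⟩
    obtain ⟨x, rfl⟩ := hw.exists_eq hk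
    have : ∃ y < N + p, factorAt u y k = factorAt u x k := by
      by_cases hx : x < N
      · exact ⟨x, by omega, rfl⟩
      · obtain ⟨y, -, hy⟩ := exists_lt_factorAt_eq hp h k (not_lt.1 hx)
        exact ⟨y, hy⟩
    obtain ⟨y, hy, hyx⟩ := this
    simp only [Finset.coe_image, Set.mem_image, Finset.coe_range, Set.mem_Iio]
    exact ⟨y, hy, hyx⟩
  refine (Set.ncard_le_ncard hsub (Finset.finite_toSet _)).trans ?_
  rw [Set.ncard_coe_finset]
  exact Finset.card_image_le.trans (by simp)

lemma exists_factorAt_eq_of_avoids [Finite α] {u : ℕ → α} {n i : ℕ} {v : List α}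
    (hn : facComplexity u n ≤ n + 1) (hv : v.length = n) (hvu : IsFactor u v)
    (h : ∀ t ≤ n, factorAt u (i + t) n ≠ v) :
    ∃ s t, s < t ∧ t ≤ n ∧ factorAt u (i + s) n = factorAt u (i + t) n := by
  classical
  have hfin := finite_wordsOfLength (language u) n
  have hcard : (hfin.toFinset.erase v).card < (Finset.range (n + 1)).card := by
    rw [Finset.card_erase_of_mem (by simpa using ⟨hv, hvu⟩), ← Set.ncard_eq_toFinset_card _ hfin,
      Finset.card_range, ← facComplexity_eq]
    omega
  obtain ⟨s, hs, t, ht, hst, heq⟩ := Finset.exists_ne_map_eq_of_card_lt_of_maps_to hcard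
    (f := fun t => factorAt u (i + t) n) (fun t ht => by
      simp only [Finset.coe_range, Set.mem_Iio] at ht
      simp only [Finset.coe_erase, Set.Finite.coe_toFinset]
      exact ⟨⟨length_factorAt _ _ _, isFactor_factorAt _ _ _⟩, h t (by omega)⟩)
  simp only [Finset.mem_range] at hs ht
  rcases lt_or_gt_of_ne hst with hlt | hlt
  · exact ⟨s, t, hlt, by omega, heq⟩
  · exact ⟨t, s, hlt, by omega, heq.symm⟩

/-- Two occurrences of a factor of length `k` with no right special factor in between force
eventual periodicity. -/
lemma periodic_of_factorAt_eq {u : ℕ → Bool} {i j k : ℕ} (hij : i < j)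
    (h : factorAt u i k = factorAt u j k)
    (hns : ∀ x, i ≤ x → x < j → factorAt u x k ∉ rightSpecial (language u) k) :
    ∀ x ≥ i, u (x + (j - i)) = u x := by
  intro x hx
  have := factorAt_add_period (i := i) (p := j - i) (by omega) (by rw [h]; congr 1; omega)
    (fun t ht => hns _ (by omega) (by omega)) (x - i)
  rw [factorAt_succ_left, factorAt_succ_left] at this
  rw [show i + (x - i) = x by omega] at this
  exact (List.cons.inj this).1.symm

end Language
section Sturmian

lemma ncard_rightSpecial_of_sturmian {u : ℕ → Bool} (h : ∀ k, 1 ≤ k → facComplexity u k = k + 1)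
    (k : ℕ) : (rightSpecial (language u) k).ncard = 1 := by
  have h1 := facComplexity_succ u k
  have h2 := h (k + 1) (by omega)
  rcases Nat.eq_zero_or_pos k with rfl | hk
  · rw [facComplexity_zero] at h1; omega
  · have := h k hk; omega

lemma isBalancedUpTo_of_sturmian {u : ℕ → Bool}
    (h : ∀ k, 1 ≤ k → facComplexity u k = k + 1) (n : ℕ) : IsBalancedUpTo (language u) n := by
  revert n
  by_contra hbal
  obtain ⟨w, hw, hext, -⟩ := exists_palindrome_of_not_balanced (isFactorial_language u) hbal
  have hwsp : w ∈ rightSpecial (language u) w.length :=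
    ⟨rfl, fun c => ((isFactorial_language u) [c] _ (hext c)).2⟩
  obtain ⟨x, hx⟩ := Set.ncard_eq_one.1 (ncard_rightSpecial_of_sturmian h (w.length + 1))
  obtain ⟨y, hy⟩ := Set.ncard_eq_one.1 (ncard_rightSpecial_of_sturmian h w.length)
  have hxm : x ∈ rightSpecial (language u) (w.length + 1) := by rw [hx]; rfl
  obtain ⟨d, z, rfl⟩ := List.exists_cons_of_length_eq_add_one hxm.1
  obtain rfl : z = w := by
    have h1 := (isFactorial_language u).subset_rightSpecial hxm
    rw [hy] at h1 hwsp
    exact h1.trans hwsp.symm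
  obtain ⟨i, hi⟩ := (hext (!d)).exists_eq (k := z.length + 2) (by simp)
  have havoid : ∀ t ≤ z.length + 1, factorAt u (i + t) (z.length + 1) ≠ d :: z := by
    intro t ht heq
    have := eq_of_factorAt_palindrome hw hi ht heq
    cases d <;> simp at this
  obtain ⟨s, t, hst, ht, heq⟩ := exists_factorAt_eq_of_avoids (h _ (by omega)).le hxm.1
    ((isFactorial_language u) _ _ (hext d)).1 havoid
  have hper := periodic_of_factorAt_eq (u := u) (by omega) heq (fun x h1 h2 hmem => by
    rw [hx] at hmem
    refine havoid (x - i) (by omega) ?_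
    rw [show i + (x - i) = x by omega]
    exact hmem)
  have h1 := facComplexity_le_of_periodic (by omega) hper (i + t)
  have h2 := h (i + t) (by omega)
  omega

lemma reverse_mem_of_sturmian {u : ℕ → Bool}
    (h : ∀ k, 1 ≤ k → facComplexity u k = k + 1) {w : List Bool} (hw : IsFactor u w) :
    IsFactor u w.reverse := by
  set M : Set (List Bool) := {w | IsFactor u w ∨ IsFactor u w.reverse} with hM
  have hMfac : IsFactorial M := by
    rintro x y (hxy | hxy)
    · exact ⟨Or.inl hxy.left_of_append, Or.inl hxy.right_of_append⟩
    · rw [List.reverse_append] at hxy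
      exact ⟨Or.inr hxy.right_of_append, Or.inr hxy.left_of_append⟩
  have hrep : ∀ x ∈ M, ∃ x' ∈ language u, x'.length = x.length ∧ x'.count true = x.count true := by
    rintro x (hx | hx)
    · exact ⟨x, hx, rfl, rfl⟩
    · exact ⟨x.reverse, hx, by simp, by simp⟩
  have hMbal : IsBalancedUpTo M w.length := by
    intro x hx y hy hxy hxn
    obtain ⟨x', hx', hxl, hxc⟩ := hrep x hx
    obtain ⟨y', hy', hyl, hyc⟩ := hrep y hy
    rw [← hxc, ← hyc]
    exact isBalancedUpTo_of_sturmian h w.length x' hx' y' hy' (by omega) (by omega)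
  rcases Nat.eq_zero_or_pos w.length with h0 | hpos
  · rw [List.length_eq_zero_iff] at h0
    subst h0
    exact hw
  have heq : wordsOfLength (language u) w.length = wordsOfLength M w.length :=
    Set.eq_of_subset_of_ncard_le (fun x hx => ⟨hx.1, Or.inl hx.2⟩)
      ((hMbal.ncard_wordsOfLength_le hMfac le_rfl).trans (h _ hpos).ge)
      (finite_wordsOfLength M _)
  have : w.reverse ∈ wordsOfLength M w.length := ⟨by simp, Or.inr (by simpa using hw)⟩
  rw [← heq] at this
  exact this.2

end Sturmian

section Palindromes

/-- The palindromic factors of length `k` of a sequence. -/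
def palindromes (u : ℕ → α) (k : ℕ) : Set (List α) :=
  {w | w.length = k ∧ IsFactor u w ∧ IsPalindrome w}

lemma palComplexity_eq (u : ℕ → α) (k : ℕ) : palComplexity u k = (palindromes u k).ncard := rfl

lemma finite_palindromes [Finite α] (u : ℕ → α) (k : ℕ) : (palindromes u k).Finite :=
  (finite_setOf_length_eq k).subset fun _ h => h.1

lemma palComplexity_zero (u : ℕ → α) : palComplexity u 0 = 1 := by
  rw [palComplexity, Set.ncard_eq_one]
  refine ⟨[], Set.ext fun w => ⟨fun h => List.length_eq_zero_iff.1 h.1, ?_⟩⟩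
  rintro rfl
  exact ⟨rfl, isFactor_factorAt u 0 0, rfl⟩

lemma palComplexity_one (u : ℕ → α) : palComplexity u 1 = facComplexity u 1 := by
  rw [palComplexity, facComplexity]
  congr 1
  ext w
  refine and_congr_right fun h => and_iff_left ?_
  obtain ⟨a, rfl⟩ := List.length_eq_one_iff.1 h
  rfl

lemma mapsTo_central (u : ℕ → α) (k : ℕ) :
    Set.MapsTo (fun w => w.tail.dropLast) (palindromes u (k + 2)) (palindromes u k) := by
  rintro w ⟨hl, hw, hp⟩
  obtain ⟨c, x, rfl, hx, hxp⟩ := hp.exists_eq_cons_append hl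
  simp only [List.cons_append, List.tail_cons, List.dropLast_concat]
  exact ⟨hx, (hw.right_of_append (x := [c])).left_of_append, hxp⟩

lemma injOn_central {u : ℕ → Bool} {k : ℕ}
    (h : ∀ w, ¬ ((w.length = k ∧ IsPalindrome w) ∧ ∀ c, IsFactor u (c :: w ++ [c]))) :
    Set.InjOn (fun w => w.tail.dropLast) (palindromes u (k + 2)) := by
  rintro w ⟨hl, hw, hp⟩ w' ⟨hl', hw', hp'⟩ heq
  obtain ⟨c, x, rfl, hx, hxp⟩ := hp.exists_eq_cons_append hl
  obtain ⟨d, y, rfl, hy, hyp⟩ := hp'.exists_eq_cons_append hl'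
  simp only [List.cons_append, List.tail_cons, List.dropLast_concat] at heq
  subst heq
  by_contra hne
  refine h x ⟨⟨hx, hxp⟩, fun e => ?_⟩
  cases c <;> cases d <;> cases e <;> simp_all

lemma IsBalancedUpTo.injOn_central {u : ℕ → Bool} (h : ∀ n, IsBalancedUpTo (language u) n)
    (k : ℕ) : Set.InjOn (fun w => w.tail.dropLast) (palindromes u (k + 2)) :=
  PalPaper.injOn_central fun w hw =>
    (h (w.length + 2)).notMem rfl le_rfl rfl (hw.2 true) (hw.2 false)

lemma surjOn_central_of_sturmian {u : ℕ → Bool}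
    (h : ∀ k, 1 ≤ k → facComplexity u k = k + 1) (k : ℕ) :
    Set.SurjOn (fun w => w.tail.dropLast) (palindromes u (k + 2)) (palindromes u k) := by
  rintro w ⟨hl, hw, hp⟩
  suffices ∃ c, IsFactor u (c :: w ++ [c]) by
    obtain ⟨c, hc⟩ := this
    exact ⟨c :: w ++ [c], ⟨by simp [hl], hc, (isPalindrome_cons_append_iff c w).2 hp⟩, by simp⟩
  obtain ⟨x, hx⟩ := Set.ncard_eq_one.1 (ncard_rightSpecial_of_sturmian h k)
  by_cases hsp : w ∈ rightSpecial (language u) k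
  · obtain ⟨y, hy⟩ := Set.ncard_eq_one.1 (ncard_rightSpecial_of_sturmian h (k + 1))
    have hym : y ∈ rightSpecial (language u) (k + 1) := by rw [hy]; rfl
    obtain ⟨c, z, rfl⟩ := List.exists_cons_of_length_eq_add_one hym.1
    obtain rfl : z = w := by
      have h1 := (isFactorial_language u).subset_rightSpecial hym
      rw [hx] at h1 hsp
      exact h1.trans hsp.symm
    exact ⟨c, hym.2 c⟩
  · obtain ⟨c, hc⟩ := hw.exists_append
    obtain ⟨d, hd⟩ := (reverse_mem_of_sturmian h hc).exists_append
    have hd' := reverse_mem_of_sturmian h hd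
    simp only [List.reverse_append, List.reverse_reverse, List.reverse_singleton] at hd'
    have hdw : IsFactor u (w ++ [d]) := by
      have := reverse_mem_of_sturmian h
        (IsFactor.left_of_append (x := d :: w) (y := [c]) (by simpa using hd'))
      rw [List.reverse_cons, hp] at this
      exact this
    have hcd : c = d := by
      by_contra hne
      refine hsp ⟨hl, fun e => ?_⟩
      cases c <;> cases d <;> cases e <;> simp_all [language]
    subst hcd
    exact ⟨c, by simpa using hd'⟩

lemma palComplexity_of_sturmian {u : ℕ → Bool}
    (h : ∀ k, 1 ≤ k → facComplexity u k = k + 1) (k : ℕ) :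
    palComplexity u (k + 2) = palComplexity u k := by
  rw [palComplexity_eq, palComplexity_eq,
    ← (surjOn_central_of_sturmian h k).image_eq_of_mapsTo (mapsTo_central u k),
    (IsBalancedUpTo.injOn_central (isBalancedUpTo_of_sturmian h) k).ncard_image]

end Palindromes

section Converse

lemma exists_isPalindrome_factorAt {u : ℕ → α} {k : ℕ} (h : palComplexity u k ≠ 0) :
    ∃ x, IsPalindrome (factorAt u x k) := by
  obtain ⟨w, hl, hw, hp⟩ := Set.nonempty_of_ncard_ne_zero h
  obtain ⟨x, rfl⟩ := hw.exists_eq hl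
  exact ⟨x, hp⟩

lemma exists_return_or_avoids {u : ℕ → Bool} {w : List Bool} {i : ℕ} {c : Bool}
    (hw : IsPalindrome w) (hn : facComplexity u (w.length + 1) ≤ w.length + 2)
    (hi : factorAt u i (w.length + 2) = c :: w ++ [c]) (hmem : IsFactor u ((!c) :: w))
    (hsp : ∀ x ∈ rightSpecial (language u) (w.length + 1), ∃ d, x = d :: w) :
    (∃ d, 0 < d ∧ d ≤ w.length + 1 ∧ factorAt u (i + d) (w.length + 1) = c :: w) ∨
      ∃ N, ∀ x ≥ N, ∀ d, factorAt u x (w.length + 1) ≠ d :: w := by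
  by_cases hret : ∃ d, 0 < d ∧ d ≤ w.length + 1 ∧ factorAt u (i + d) (w.length + 1) = c :: w
  · exact Or.inl hret
  right
  obtain ⟨s, t, hst, ht, heq⟩ := exists_factorAt_eq_of_avoids hn (by simp) hmem
    (fun t ht heq => by
      have := eq_of_factorAt_palindrome hw hi ht heq
      cases c <;> simp at this)
  have hs : 0 < s := by
    rcases Nat.eq_zero_or_pos s with rfl | hs
    · refine absurd ⟨t, hst, ht, ?_⟩ hret
      rw [← heq, Nat.add_zero, factorAt_eq_cons_iff]
      have := (factorAt_eq_cons_append_iff _ _ _ _ _ _).1 hi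
      exact ⟨this.1, this.2.1⟩
    · exact hs
  have havoid : ∀ x, i + s ≤ x → x < i + t → ∀ d, factorAt u x (w.length + 1) ≠ d :: w := by
    intro x h1 h2 d hd
    obtain ⟨r, rfl⟩ := Nat.exists_eq_add_of_le (show i ≤ x by omega)
    obtain rfl := eq_of_factorAt_palindrome hw hi (by omega) hd
    exact hret ⟨r, by omega, by omega, hd⟩
  have hper := periodic_of_factorAt_eq (by omega) heq (fun x h1 h2 hx => by
    obtain ⟨d, hd⟩ := hsp _ hx
    exact havoid x h1 h2 d hd)
  refine ⟨i + s, fun x hx d hd => ?_⟩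
  obtain ⟨y, h1, h2, hy⟩ := exists_lt_factorAt_eq (by omega) hper (w.length + 1) hx
  exact havoid y h1 (by omega) d (hy.trans hd)

/-- If the two palindromic returns to `w` had lengths `d c ≤ d c'`, the palindromes they span
would be distinct of equal even length, or the shorter one would reveal an earlier return. -/
lemma not_le_of_minimal_returns {u : ℕ → α} {w : List α} (hw : IsPalindrome w)
    (heven : ∀ k x y, Even k → 2 ≤ k → IsPalindrome (factorAt u x k) →
      IsPalindrome (factorAt u y k) → factorAt u x k = factorAt u y k)
    {c c' : α} (hne : c ≠ c') {i i' d d' : ℕ} (hd : 0 < d)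
    (hm : Even (w.length + d)) (hm' : Even (w.length + d'))
    (hdm : d ≤ w.length + 1) (hdm' : d' ≤ w.length + 1)
    (hi : factorAt u i (w.length + 2) = c :: w ++ [c])
    (hi' : factorAt u i' (w.length + 2) = c' :: w ++ [c'])
    (hr : factorAt u (i + d) (w.length + 1) = c :: w)
    (hr' : factorAt u (i' + d') (w.length + 1) = c' :: w)
    (hmin' : ∀ e, 0 < e → e < d' → factorAt u (i' + e) (w.length + 1) ≠ c' :: w) :
    ¬ d ≤ d' := by
  intro hle
  have hc := (factorAt_eq_cons_append_iff _ _ _ _ _ _).1 hi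
  have hc' := (factorAt_eq_cons_append_iff _ _ _ _ _ _).1 hi'
  have hp := isPalindrome_of_return hw hc.2.1 ((factorAt_eq_cons_iff _ _ _ _ _).1 hr).2 hdm
  have hp' := isPalindrome_of_return hw hc'.2.1 ((factorAt_eq_cons_iff _ _ _ _ _).1 hr').2 hdm'
  obtain ⟨r, hr2⟩ : ∃ r, d' = d + 2 * r := by
    obtain ⟨a, ha⟩ := hm
    obtain ⟨b, hb⟩ := hm'
    exact ⟨b - a, by omega⟩
  rw [hr2, ← add_assoc] at hp'
  have heq := heven _ _ _ hm (by obtain ⟨a, ha⟩ := hm; omega) hp hp'.central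
  rw [factorAt_eq_iff] at heq
  rcases Nat.eq_zero_or_pos r with rfl | hrpos
  · apply hne
    rw [← hc.2.2, ← hc'.2.2]
    simpa using heq w.length (by omega)
  · have h1 : factorAt u (i' + r) (w.length + 1) = u (i' + r) :: w := by
      rw [factorAt_eq_cons_iff]
      refine ⟨rfl, ?_⟩
      refine Eq.trans ((factorAt_eq_iff _ _ _ _).2 fun t ht => ?_) hc.2.1
      rw [heq t (by omega)]
      congr 1; omega
    have h2 := eq_of_factorAt_palindrome hw hi' (by omega) h1
    rw [h2] at h1
    exact hmin' r hrpos (by omega) h1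

lemma odd_of_minimal_return {u : ℕ → α} {w : List α} (hw : IsPalindrome w)
    (hcenter : ∀ x r, 0 < r → IsPalindrome (factorAt u x (w.length + 2 * r)) →
      factorAt u (x + r) w.length = w)
    {c : α} {i d : ℕ} (hd : 0 < d) (hdm : d ≤ w.length + 1)
    (hi : factorAt u i (w.length + 2) = c :: w ++ [c])
    (hr : factorAt u (i + d) (w.length + 1) = c :: w)
    (hmin : ∀ e, 0 < e → e < d → factorAt u (i + e) (w.length + 1) ≠ c :: w) : Odd d := by
  by_contra hodd
  obtain ⟨r, hr2⟩ := Nat.not_odd_iff_even.1 hodd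
  obtain rfl : d = 2 * r := by omega
  have hc := (factorAt_eq_cons_append_iff _ _ _ _ _ _).1 hi
  have h1 := hcenter _ r (by omega)
    (isPalindrome_of_return hw hc.2.1 ((factorAt_eq_cons_iff _ _ _ _ _).1 hr).2 hdm)
  have h2 : factorAt u (i + r) (w.length + 1) = u (i + r) :: w := by
    rw [factorAt_eq_cons_iff]
    exact ⟨rfl, by rw [← h1, length_factorAt]; congr 1; omega⟩
  have h3 := eq_of_factorAt_palindrome hw hi (by omega) h2
  rw [h3] at h2
  exact hmin r (by omega) (by omega) h2

lemma palindromes_add_two_eq {u : ℕ → Bool} {w : List Bool} (hw : IsPalindrome w)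
    (hext : ∀ c, IsFactor u (c :: w ++ [c])) (h : palComplexity u (w.length + 2) = 2) :
    palindromes u (w.length + 2) = {true :: w ++ [true], false :: w ++ [false]} := by
  symm
  refine Set.eq_of_subset_of_ncard_le ?_ ?_ (finite_palindromes u _)
  · rintro x (rfl | rfl) <;>
      exact ⟨by simp, hext _, (isPalindrome_cons_append_iff _ _).2 hw⟩
  · rw [← palComplexity_eq, h, Set.ncard_pair (by simp)]

lemma isBalancedUpTo_of_palComplexity {u : ℕ → Bool} (h2 : ∀ k, Odd k → palComplexity u k = 2)
    (h1 : ∀ k, Even k → 2 ≤ k → palComplexity u k = 1) (n : ℕ) :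
    IsBalancedUpTo (language u) n := by
  revert n
  by_contra hbal
  have hfac := isFactorial_language u
  obtain ⟨w, hw, hext, hwbal⟩ := exists_palindrome_of_not_balanced hfac hbal
  have heven : ∀ k x y, Even k → 2 ≤ k → IsPalindrome (factorAt u x k) →
      IsPalindrome (factorAt u y k) → factorAt u x k = factorAt u y k := by
    intro k x y hk hk2 hx hy
    obtain ⟨z, hz⟩ := Set.ncard_eq_one.1 (h1 k hk hk2)
    have hmem : ∀ x, IsPalindrome (factorAt u x k) → factorAt u x k = z := fun x hx => by
      have : factorAt u x k ∈ ({z} : Set (List Bool)) := by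
        rw [← hz]; exact ⟨length_factorAt _ _ _, isFactor_factorAt _ _ _, hx⟩
      exact this
    rw [hmem x hx, hmem y hy]
  have hocc : ∀ c, ∃ i, factorAt u i (w.length + 2) = c :: w ++ [c] := fun c =>
    (hext c).exists_eq (by simp)
  have hodd : Odd w.length := by
    by_contra hodd
    have hev := Nat.not_odd_iff_even.1 hodd
    obtain ⟨i, hi⟩ := hocc true
    obtain ⟨j, hj⟩ := hocc false
    have hp : ∀ c, IsPalindrome (c :: w ++ [c]) := fun c => (isPalindrome_cons_append_iff _ _).2 hw
    have := heven (w.length + 2) i j (by simpa [Nat.even_add] using hev) (by omega)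
      (hi ▸ hp true) (hj ▸ hp false)
    rw [hi, hj] at this
    simp at this
  have hodd' : ∀ r, Odd (w.length + 2 * r) := fun r => hodd.add_even (even_two_mul r)
  have hpal := palindromes_add_two_eq hw hext (h2 _ (hodd' 1))
  have hcenter : ∀ x r, 0 < r → IsPalindrome (factorAt u x (w.length + 2 * r)) →
      factorAt u (x + r) w.length = w := by
    intro x r hr hx
    obtain ⟨r, rfl⟩ := Nat.exists_eq_add_of_lt hr
    rw [show w.length + 2 * (0 + r + 1) = w.length + 2 + 2 * r by ring] at hx
    have hmem : factorAt u (x + r) (w.length + 2) ∈ palindromes u (w.length + 2) :=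
      ⟨length_factorAt _ _ _, isFactor_factorAt _ _ _, hx.central⟩
    rw [hpal] at hmem
    rw [show x + (0 + r + 1) = x + r + 1 by ring]
    rcases hmem with hmem | hmem <;>
      exact ((factorAt_eq_cons_append_iff _ _ _ _ _ _).1 hmem).2.1
  have hrec : ¬ ∃ N, ∀ x ≥ N, ∀ d, factorAt u x (w.length + 1) ≠ d :: w := by
    rintro ⟨N, hN⟩
    obtain ⟨x, hx⟩ := exists_isPalindrome_factorAt (u := u) (k := w.length + 2 * (N + 1))
      (by rw [h2 _ (hodd' _)]; simp)
    refine hN (x + N) (by omega) (u (x + N)) ?_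
    rw [factorAt_eq_cons_iff]
    exact ⟨rfl, hcenter x (N + 1) (by omega) hx⟩
  have hwsp : w ∈ rightSpecial (language u) w.length :=
    ⟨rfl, fun c => (hfac [c] _ (hext c)).2⟩
  have hsp : ∀ x ∈ rightSpecial (language u) (w.length + 1), ∃ d, x = d :: w := by
    intro x hx
    obtain ⟨d, z, rfl⟩ := List.exists_cons_of_length_eq_add_one hx.1
    exact ⟨d, by rw [hwbal.rightSpecial_subsingleton hfac (by omega)
      (hfac.subset_rightSpecial hx) hwsp]⟩
  choose i hi using hocc
  have hret : ∀ c, ∃ d, 0 < d ∧ d ≤ w.length + 1 ∧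
      factorAt u (i c + d) (w.length + 1) = c :: w := fun c =>
    (exists_return_or_avoids hw (hwbal.ncard_wordsOfLength_le hfac le_rfl) (hi c)
      ((hfac _ _ (hext !c)).1) hsp).resolve_right hrec
  classical
  have hmin : ∀ c, ∃ d, (0 < d ∧ d ≤ w.length + 1 ∧
      factorAt u (i c + d) (w.length + 1) = c :: w) ∧
      ∀ e, 0 < e → e < d → factorAt u (i c + e) (w.length + 1) ≠ c :: w := fun c =>
    ⟨Nat.find (hret c), Nat.find_spec (hret c), fun e he hlt heq =>
      Nat.find_min (hret c) hlt ⟨he, by have := (Nat.find_spec (hret c)).2.1; omega, heq⟩⟩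
  choose d hd hdmin using hmin
  have hdeven : ∀ c, Even (w.length + d c) := fun c => hodd.add_odd
    (odd_of_minimal_return hw hcenter (hd c).1 (hd c).2.1 (hi c) (hd c).2.2 (hdmin c))
  have hnle : ∀ c c', c ≠ c' → ¬ d c ≤ d c' := fun c c' hne =>
    not_le_of_minimal_returns hw heven hne (hd c).1 (hdeven c) (hdeven c') (hd c).2.1
      (hd c').2.1 (hi c) (hi c') (hd c).2.2 (hd c').2.2 (hdmin c')
  have ha := hnle true false (by simp)
  have hb := hnle false true (by simp)
  omega

lemma exists_palindrome_with_center {u : ℕ → Bool}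
    (h2 : ∀ k, Odd k → palComplexity u k = 2) (hbal : ∀ n, IsBalancedUpTo (language u) n)
    (c : Bool) (r : ℕ) : ∃ x, IsPalindrome (factorAt u x (2 * r + 1)) ∧ u (x + r) = c := by
  induction r with
  | zero =>
    have hsub : palindromes u 1 ⊆ {[true], [false]} := by
      rintro w ⟨hl, -, -⟩
      obtain ⟨a, rfl⟩ := List.length_eq_one_iff.1 hl
      cases a <;> simp
    have heq := Set.eq_of_subset_of_ncard_le hsub
      (by rw [← palComplexity_eq, h2 1 odd_one, Set.ncard_pair (by simp)]) (Set.toFinite _)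
    have hmem : [c] ∈ palindromes u 1 := by rw [heq]; cases c <;> simp
    obtain ⟨x, hx⟩ := hmem.2.1.exists_eq (k := 1) rfl
    refine ⟨x, ?_, ?_⟩
    · rw [mul_zero, zero_add, hx]; rfl
    · rw [factorAt_one] at hx
      simpa using hx
  | succ r ih =>
    obtain ⟨x, hx, hxc⟩ := ih
    have himg : (fun w => w.tail.dropLast) '' palindromes u (2 * r + 1 + 2) =
        palindromes u (2 * r + 1) := by
      refine Set.eq_of_subset_of_ncard_le (mapsTo_central u _).image_subset ?_
        (finite_palindromes u _)
      rw [(IsBalancedUpTo.injOn_central hbal _).ncard_image, ← palComplexity_eq,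
        ← palComplexity_eq, h2 _ (by simp), h2 _ (by simp [parity_simps])]
    have hmem : factorAt u x (2 * r + 1) ∈ palindromes u (2 * r + 1) :=
      ⟨length_factorAt _ _ _, isFactor_factorAt _ _ _, hx⟩
    rw [← himg] at hmem
    obtain ⟨y, ⟨hl, hy, hyp⟩, hyx⟩ := hmem
    obtain ⟨z, rfl⟩ := hy.exists_eq hl
    refine ⟨z, hyp, ?_⟩
    have h3 : factorAt u (z + 1) (2 * r + 1) = factorAt u x (2 * r + 1) := by
      have h4 : factorAt u z (2 * r + 1 + 2) =
          u z :: (factorAt u (z + 1) (2 * r + 1) ++ [u (z + 1 + (2 * r + 1))]) := by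
        rw [← factorAt_succ, ← factorAt_succ_left]
      rw [← hyx, h4]
      simp
    have := (factorAt_eq_iff _ _ _ _).1 h3 r (by omega)
    rw [← hxc, ← this]
    congr 1; ring

lemma exists_periodic_of_facComplexity_le {u : ℕ → Bool} {k : ℕ} (h : facComplexity u k ≤ k) :
    ∃ N p, 0 < p ∧ ∀ x ≥ N, u (x + p) = u x := by
  obtain ⟨j, hj⟩ : ∃ j, facComplexity u (j + 1) ≤ facComplexity u j := by
    by_contra! hlt
    have : ∀ j, j + 1 ≤ facComplexity u j := by
      intro j
      induction j with
      | zero => rw [facComplexity_zero]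
      | succ j ih => have := hlt j; omega
    have := this k
    omega
  have hsp : rightSpecial (language u) j = ∅ := by
    rw [← Set.ncard_eq_zero (finite_rightSpecial _ _)]
    rw [facComplexity_succ] at hj
    omega
  obtain ⟨s, -, t, -, hst, heq⟩ := Set.infinite_univ.exists_lt_map_eq_of_mapsTo
    (f := fun x => factorAt u x j) (t := {w : List Bool | w.length = j})
    (fun x _ => length_factorAt u x j) (finite_setOf_length_eq j)
  exact ⟨s, t - s, by omega, periodic_of_factorAt_eq hst heq (by simp [hsp])⟩

/-- The two-sided periodic extension of the tail of an eventually periodic sequence. -/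
lemma exists_periodic_extension {u : ℕ → α} {N p : ℕ}
    (h : ∀ x ≥ N, u (x + p) = u x) :
    ∃ z : ℤ → α, Function.Periodic z (p : ℤ) ∧ ∀ x ≥ N, z (x : ℤ) = u x := by
  refine ⟨fun x => u (N + ((x - N) % p).toNat), fun x => ?_, fun x hx => ?_⟩
  · simp only
    rw [show x + p - N = x - N + p by ring, Int.add_emod_right]
  · obtain ⟨y, rfl⟩ := Nat.exists_eq_add_of_le hx
    have key : ∀ q r, u (N + (r + p * q)) = u (N + r) := by
      intro q r
      induction q with
      | zero => simp
      | succ q ih => 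
        rw [← ih, ← h (N + (r + p * q)) (by omega)]
        congr 1; ring
    have h1 : (((N + y : ℕ) : ℤ) - N) % p = ((y % p : ℕ) : ℤ) := by push_cast; simp
    simp only [h1, Int.toNat_natCast]
    rw [← key (y / p) (y % p), Nat.mod_add_div]

/-- A long palindrome in an eventually periodic sequence gives a symmetry of the two-sided
periodic extension. -/
lemma reflection_of_isPalindrome {u : ℕ → α} {z : ℤ → α} {N p x k : ℕ} (hp : 0 < p)
    (hz : Function.Periodic z (p : ℤ)) (hzu : ∀ x ≥ N, z (x : ℤ) = u x)
    (hk : 2 * (N + p) ≤ k) (hx : IsPalindrome (factorAt u x k)) (y : ℤ) :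
    z (2 * x + k - 1 - y) = z y := by
  rw [isPalindrome_factorAt_iff] at hx
  set b : ℤ := x + (N + p : ℕ) - y with hb
  have hr0 : 0 ≤ b % p := Int.emod_nonneg _ (by omega)
  have hr1 : b % p < p := Int.emod_lt_of_pos _ (by omega)
  obtain ⟨r, hr⟩ := Int.eq_ofNat_of_zero_le hr0
  have hbr : b = r + b / p * p := by rw [← hr]; exact (Int.emod_add_ediv_mul b p).symm
  have hy : y = ((x + (N + p - r) : ℕ) : ℤ) - b / p * p := by
    push_cast [show r ≤ N + p by omega] at *
    omega
  have h1 := hx (N + p - r) (by omega)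
  rw [← hzu _ (by omega), ← hzu _ (by omega)] at h1
  have h2 : z y = z ((x + (N + p - r) : ℕ) : ℤ) := by
    rw [hy]
    exact hz.sub_int_mul_eq _
  have h3 : z (2 * x + k - 1 - y) = z ((x + (k - 1 - (N + p - r)) : ℕ) : ℤ) := by
    rw [← (hz.int_mul (b / p)) ((x + (k - 1 - (N + p - r)) : ℕ) : ℤ)]
    congr 1
    rw [hy]
    push_cast [show r ≤ N + p by omega, show 1 ≤ k by omega, show N + p - r ≤ k - 1 by omega]
    ring
  rw [h3, h2, h1]

lemma sturmian_of_palComplexity {u : ℕ → Bool} (h2 : ∀ k, Odd k → palComplexity u k = 2)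
    (h1 : ∀ k, Even k → 2 ≤ k → palComplexity u k = 1) (k : ℕ) :
    facComplexity u k = k + 1 := by
  have hbal := isBalancedUpTo_of_palComplexity h2 h1
  have hle : facComplexity u k ≤ k + 1 :=
    (hbal k).ncard_wordsOfLength_le (isFactorial_language u) le_rfl
  by_contra hne
  obtain ⟨N, p, hp, hper⟩ := exists_periodic_of_facComplexity_le (u := u) (k := k) (by omega)
  obtain ⟨z, hz, hzu⟩ := exists_periodic_extension hper
  set r := N + p with hr
  obtain ⟨a, ha, hac⟩ := exists_palindrome_with_center h2 hbal true r
  obtain ⟨b, hb, hbc⟩ := exists_palindrome_with_center h2 hbal false r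
  obtain ⟨e, he⟩ := exists_isPalindrome_factorAt (u := u) (k := 2 * r)
    (by rw [h1 _ (by simp) (by omega)]; simp)
  have hza := reflection_of_isPalindrome hp hz hzu (by omega) ha
  have hzb := reflection_of_isPalindrome hp hz hzu (by omega) hb
  have hze := reflection_of_isPalindrome hp hz hzu (by omega) he
  push_cast at hza hzb hze
  have hper1 : Function.Periodic z (2 * (a - b) : ℤ) := fun y => by
    rw [← hza, ← hzb y]; congr 1; ring
  have hper2 : Function.Periodic z (2 * (a - e) + 1 : ℤ) := fun y => by
    rw [← hza, ← hze y]; congr 1; ring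
  have hper3 : Function.Periodic z (a - b : ℤ) := by
    have := (hper2.int_mul (a - b)).sub_period (hper1.int_mul (a - e))
    simp only [Int.cast_id] at this
    rwa [show (a - b : ℤ) * (2 * (a - e) + 1) - (a - e) * (2 * (a - b)) = a - b by ring] at this
  have h3 := hper3 ((b + r : ℕ) : ℤ)
  rw [hzu (b + r) (by omega), hbc,
    show ((b + r : ℕ) : ℤ) + (a - b) = ((a + r : ℕ) : ℤ) by push_cast; ring,
    hzu (a + r) (by omega), hac] at h3
  exact Bool.noConfusion h3

end Converse

section Transfer

variable {β : Type*} {f : β → α}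

lemma factorAt_comp (f : β → α) (v : ℕ → β) (i k : ℕ) :
    factorAt (f ∘ v) i k = (factorAt v i k).map f := by
  simp [factorAt]

lemma facComplexity_comp (hf : Function.Injective f) (v : ℕ → β) (k : ℕ) :
    facComplexity (f ∘ v) k = facComplexity v k := by
  rw [facComplexity, facComplexity, ← Set.ncard_image_of_injective _ hf.list_map]
  congr 1
  ext w
  constructor
  · rintro ⟨hl, hw⟩
    obtain ⟨i, rfl⟩ := hw.exists_eq hl
    exact ⟨factorAt v i k, ⟨length_factorAt _ _ _, isFactor_factorAt _ _ _⟩,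
      (factorAt_comp f v i k).symm⟩
  · rintro ⟨x, ⟨hl, hx⟩, rfl⟩
    obtain ⟨i, rfl⟩ := hx.exists_eq hl
    exact ⟨by simp [length_factorAt], by rw [← factorAt_comp]; exact isFactor_factorAt _ _ _⟩

lemma palComplexity_comp (hf : Function.Injective f) (v : ℕ → β) (k : ℕ) :
    palComplexity (f ∘ v) k = palComplexity v k := by
  have hpal : ∀ x : List β, IsPalindrome (x.map f) ↔ IsPalindrome x := fun x => by
    rw [IsPalindrome, ← List.map_reverse, hf.list_map.eq_iff, IsPalindrome]
  rw [palComplexity, palComplexity, ← Set.ncard_image_of_injective _ hf.list_map]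
  congr 1
  ext w
  constructor
  · rintro ⟨hl, hw, hp⟩
    obtain ⟨i, rfl⟩ := hw.exists_eq hl
    rw [factorAt_comp, hpal] at hp
    exact ⟨factorAt v i k, ⟨length_factorAt _ _ _, isFactor_factorAt _ _ _, hp⟩,
      (factorAt_comp f v i k).symm⟩
  · rintro ⟨x, ⟨hl, hx, hp⟩, rfl⟩
    obtain ⟨i, rfl⟩ := hx.exists_eq hl
    exact ⟨by simp [length_factorAt], by rw [← factorAt_comp]; exact isFactor_factorAt _ _ _,
      (hpal _).2 hp⟩

lemma exists_bool_coding {u : ℕ → α} (h : facComplexity u 1 = 2) :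
    ∃ (f : Bool → α) (v : ℕ → Bool), Function.Injective f ∧ u = f ∘ v := by
  classical
  obtain ⟨x, y, hxy, hset⟩ := Set.ncard_eq_two.1 h
  have hmem : ∀ i, [u i] = x ∨ [u i] = y := fun i => by
    have : [u i] ∈ ({x, y} : Set (List α)) := by
      rw [← hset, ← factorAt_one]
      exact ⟨length_factorAt _ _ _, isFactor_factorAt _ _ _⟩
    exact this
  have hx : x.length = 1 := by
    have : x ∈ ({x, y} : Set (List α)) := by simp
    rw [← hset] at this; exact this.1
  have hy : y.length = 1 := by
    have : y ∈ ({x, y} : Set (List α)) := by simp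
    rw [← hset] at this; exact this.1
  obtain ⟨a, rfl⟩ := List.length_eq_one_iff.1 hx
  obtain ⟨b, rfl⟩ := List.length_eq_one_iff.1 hy
  simp only [List.cons.injEq, and_true, ne_eq] at hmem hxy
  refine ⟨fun c => bif c then a else b, fun i => decide (u i = a), ?_, ?_⟩
  · rintro (_ | _) (_ | _) hcd <;> simp_all
  · funext i
    by_cases hi : u i = a
    · simp [hi]
    · simpa [hi] using (hmem i).resolve_left hi

end Transfer

lemma sturmian_iff_palComplexity (u : ℕ → Bool) :
    (∀ k, 1 ≤ k → facComplexity u k = k + 1) ↔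
      ((∀ k, Odd k → palComplexity u k = 2) ∧
       (∀ k, Even k → 2 ≤ k → palComplexity u k = 1)) := by
  refine ⟨fun h => ⟨?_, ?_⟩, fun h k _ => sturmian_of_palComplexity h.1 h.2 k⟩
  · rintro k ⟨r, rfl⟩
    induction r with
    | zero => rw [mul_zero, zero_add, palComplexity_one, h 1 le_rfl]
    | succ r ih => exact (palComplexity_of_sturmian h (2 * r + 1)).trans ih
  · rintro k ⟨r, rfl⟩ -
    induction r with
    | zero => exact palComplexity_zero u
    | succ r ih =>
      rw [show r + 1 + (r + 1) = r + r + 2 by ring]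
      exact (palComplexity_of_sturmian h _).trans ih

/-- Droubay–Pirillo: a sequence is Sturmian iff it has exactly two palindromic
factors of each odd length and exactly one of each even length `≥ 2`. -/
theorem stmt6 {α : Type*} [Fintype α] (u : ℕ → α) :
    (∀ k, 1 ≤ k → facComplexity u k = k + 1) ↔
      ((∀ k, Odd k → palComplexity u k = 2) ∧
       (∀ k, Even k → 2 ≤ k → palComplexity u k = 1)) := by
  have transfer : facComplexity u 1 = 2 → ((∀ k, 1 ≤ k → facComplexity u k = k + 1) ↔
      ((∀ k, Odd k → palComplexity u k = 2) ∧
       (∀ k, Even k → 2 ≤ k → palComplexity u k = 1))) := by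
    intro h
    obtain ⟨f, v, hf, rfl⟩ := exists_bool_coding h
    simp only [facComplexity_comp hf, palComplexity_comp hf]
    exact sturmian_iff_palComplexity v
  refine ⟨fun h => (transfer (h 1 le_rfl)).1 h, fun h => (transfer ?_).2 h⟩
  rw [← palComplexity_one, h.1 1 odd_one]

end PalPaper
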